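/- If T contains all subterms of sentences in Γ ∪ {φ} and Γ determines existentials for T, then Γ ⊨ φ if and only if Γ ⊢₀ φ. -/

import Mathlib

inductive Tm (P R : Type) : Type
  | noun : P → Tm P R
  | allT : R → Tm P R → Tm P R

inductive Sent (P R : Type) : Type
  | allS : Tm P R → Tm P R → Sent P R
  | someS : Tm P R → Tm P R → Sent P R

structure Model (P R : Type) where
  W : Type
  nounI : P → Set W
  verbI : R → W → W → Prop

def Tm.interp {P R : Type} (M : Model P R) : Tm P R → Set M.W
  | .noun p => M.nounI p
  | .allT r x => {m | ∀ n ∈ Tm.interp M x, M.verbI r m n}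

def Model.sat {P R : Type} (M : Model P R) : Sent P R → Prop
  | .allS x y => Tm.interp M x ⊆ Tm.interp M y
  | .someS x y => (Tm.interp M x ∩ Tm.interp M y).Nonempty

def entails {P R : Type} (Γ : Set (Sent P R)) (φ : Sent P R) : Prop :=
  ∀ M : Model P R, (∀ ψ ∈ Γ, M.sat ψ) → M.sat φ

inductive Proves0 {P R : Type} (Γ : Set (Sent P R)) : Sent P R → Prop
  | hyp {φ} : φ ∈ Γ → Proves0 Γ φ
  | ax (x : Tm P R) : Proves0 Γ (Sent.allS x x)
  | barbara {x y z} : Proves0 Γ (Sent.allS x y) → Proves0 Γ (Sent.allS y z) →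
      Proves0 Γ (Sent.allS x z)
  | anti {x y} (r : R) : Proves0 Γ (Sent.allS x y) →
      Proves0 Γ (Sent.allS (Tm.allT r y) (Tm.allT r x))
  | some1 {x y} : Proves0 Γ (Sent.someS x y) → Proves0 Γ (Sent.someS x x)
  | some2 {x y} : Proves0 Γ (Sent.someS x y) → Proves0 Γ (Sent.someS y x)
  | darii {x y z} : Proves0 Γ (Sent.someS x y) → Proves0 Γ (Sent.allS y z) →
      Proves0 Γ (Sent.someS x z)

def Tm.subterms {P R : Type} : Tm P R → Set (Tm P R)
  | .noun p => {Tm.noun p}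
  | .allT r x => insert (Tm.allT r x) (Tm.subterms x)

def Sent.subterms {P R : Type} : Sent P R → Set (Tm P R)
  | .allS x y => x.subterms ∪ y.subterms
  | .someS x y => x.subterms ∪ y.subterms

/-- Γ determines existentials for T. -/
def DetExist {P R : Type} (Γ : Set (Sent P R)) (T : Set (Tm P R)) : Prop :=
  ∀ (r : R), ∀ x ∈ T, ∀ y ∈ T,
    Proves0 Γ (Sent.someS x x) ∨ Proves0 Γ (Sent.allS y (Tm.allT r x))

theorem sound0 {P R : Type} (Γ : Set (Sent P R)) (φ : Sent P R) (h : Proves0 Γ φ) :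
    entails Γ φ := by
  intro M hM
  induction h with
  | hyp h => exact hM _ h
  | ax x => exact fun _ h => h
  | barbara _ _ h1 h2 => exact fun _ h => h2 (h1 h)
  | anti r _ h1 => exact fun m hm n hn => hm n (h1 hn)
  | some1 _ h => exact ⟨h.choose, h.choose_spec.1, h.choose_spec.1⟩
  | some2 _ h => exact ⟨h.choose, h.choose_spec.2, h.choose_spec.1⟩
  | darii _ _ h h2 => exact ⟨h.choose, h.choose_spec.1, h2 h.choose_spec.2⟩

/-- The point `w`, a pair of terms, lies below the term `x`. -/
def below {P R : Type} (Γ : Set (Sent P R)) (w : Tm P R × Tm P R) (x : Tm P R) : Prop :=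
  Proves0 Γ (Sent.allS w.1 x) ∨ Proves0 Γ (Sent.allS w.2 x)

theorem below_mono {P R : Type} {Γ : Set (Sent P R)} {w : Tm P R × Tm P R} {x y : Tm P R}
    (h : below Γ w x) (hxy : Proves0 Γ (Sent.allS x y)) : below Γ w y :=
  h.imp (fun h => h.barbara hxy) (fun h => h.barbara hxy)

/-- Canonical model whose points are the pairs of terms satisfying `E`. -/
def canon {P R : Type} (Γ : Set (Sent P R)) (E : Tm P R × Tm P R → Prop) : Model P R where
  W := {w : Tm P R × Tm P R // E w}
  nounI p := {w | below Γ w.1 (Tm.noun p)}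
  verbI r w n := ∃ z, below Γ n.1 z ∧ below Γ w.1 (Tm.allT r z)

theorem mem_subterms_self {P R : Type} (x : Tm P R) : x ∈ x.subterms := by
  cases x <;> simp [Tm.subterms]

theorem truth {P R : Type} (Γ : Set (Sent P R)) (T : Set (Tm P R))
    (E : Tm P R × Tm P R → Prop) (hT : ∀ w, E w → w.1 ∈ T)
    (hE : ∀ r, ∀ x ∈ T, E (x, x) ∨ ∀ y ∈ T, Proves0 Γ (Sent.allS y (Tm.allT r x)))
    (x : Tm P R) (hx : x.subterms ⊆ T) (w : (canon Γ E).W) :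
    w ∈ x.interp (canon Γ E) ↔ below Γ w.1 x := by
  induction x generalizing w with
  | noun p => exact Iff.rfl
  | allT r x ih =>
    have hx' : x.subterms ⊆ T := fun y hy => hx (Set.mem_insert_of_mem _ hy)
    have ih := ih hx'
    constructor
    · intro h
      rcases hE r x (hx' (mem_subterms_self x)) with h1 | h1
      · obtain ⟨z, hz, hw⟩ := h ⟨(x, x), h1⟩ ((ih _).2 (Or.inl (Proves0.ax x)))
        have hz : Proves0 Γ (Sent.allS x z) := hz.elim id id
        exact below_mono hw (hz.anti r)
      · exact Or.inl (h1 _ (hT _ w.2))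
    · intro h n hn
      exact ⟨x, (ih n).1 hn, h⟩

theorem canon_sat {P R : Type} (Γ : Set (Sent P R)) (T : Set (Tm P R))
    (hsub : ∀ ψ ∈ Γ, Sent.subterms ψ ⊆ T)
    (E : Tm P R × Tm P R → Prop) (hT : ∀ w, E w → w.1 ∈ T)
    (hE : ∀ r, ∀ x ∈ T, E (x, x) ∨ ∀ y ∈ T, Proves0 Γ (Sent.allS y (Tm.allT r x)))
    (hS : ∀ x ∈ T, ∀ y, Proves0 Γ (Sent.someS x y) → E (x, y)) :
    ∀ ψ ∈ Γ, (canon Γ E).sat ψ := by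
  intro ψ hψ
  have hs := hsub ψ hψ
  cases ψ with
  | allS x y =>
    have hs := Set.union_subset_iff.1 hs
    intro w hw
    exact (truth Γ T E hT hE y hs.2 w).2
      (below_mono ((truth Γ T E hT hE x hs.1 w).1 hw) (Proves0.hyp hψ))
  | someS x y =>
    have hs := Set.union_subset_iff.1 hs
    exact ⟨⟨(x, y), hS x (hs.1 (mem_subterms_self x)) y (Proves0.hyp hψ)⟩,
      (truth Γ T E hT hE x hs.1 _).2 (Or.inl (Proves0.ax x)),
      (truth Γ T E hT hE y hs.2 _).2 (Or.inr (Proves0.ax y))⟩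

/-- If T contains all subterms of sentences in Γ ∪ {φ} and Γ determines
existentials for T, then Γ ⊨ φ iff Γ ⊢₀ φ. -/
theorem stmt4 {P R : Type} (Γ : Set (Sent P R)) (φ : Sent P R) (T : Set (Tm P R))
    (hsub : ∀ ψ ∈ Γ ∪ {φ}, Sent.subterms ψ ⊆ T)
    (hde : DetExist Γ T) :
    entails Γ φ ↔ Proves0 Γ φ := by
  refine ⟨fun h => ?_, sound0 Γ φ⟩
  have hΓ : ∀ ψ ∈ Γ, Sent.subterms ψ ⊆ T := fun ψ hψ => hsub ψ (Or.inl hψ)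
  have hφ : Sent.subterms φ ⊆ T := hsub φ (Or.inr rfl)
  cases φ with
  | allS x y =>
    have hs := Set.union_subset_iff.1 hφ
    let E : Tm P R × Tm P R → Prop := fun w => w.1 ∈ T
    have hT : ∀ w, E w → w.1 ∈ T := fun _ h => h
    have hE : ∀ r, ∀ x ∈ T, E (x, x) ∨ ∀ y ∈ T, Proves0 Γ (Sent.allS y (Tm.allT r x)) :=
      fun r x hx => Or.inl hx
    have hM := h (canon Γ E) (canon_sat Γ T hΓ E hT hE (fun x hx _ _ => hx))
    have hxT : E (x, x) := hs.1 (mem_subterms_self x)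
    have h1 := hM ((truth Γ T E hT hE x hs.1 ⟨(x, x), hxT⟩).2 (Or.inl (Proves0.ax x)))
    exact ((truth Γ T E hT hE y hs.2 _).1 h1).elim id id
  | someS x y =>
    have hs := Set.union_subset_iff.1 hφ
    let E : Tm P R × Tm P R → Prop := fun w => w.1 ∈ T ∧ Proves0 Γ (Sent.someS w.1 w.2)
    have hT : ∀ w, E w → w.1 ∈ T := fun _ h => h.1
    have hE : ∀ r, ∀ x ∈ T, E (x, x) ∨ ∀ y ∈ T, Proves0 Γ (Sent.allS y (Tm.allT r x)) := by
      intro r x hx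
      by_cases hxx : Proves0 Γ (Sent.someS x x)
      · exact Or.inl ⟨hx, hxx⟩
      · exact Or.inr fun y hy => (hde r x hx y hy).resolve_left hxx
    obtain ⟨⟨⟨a, b⟩, haT, hab⟩, hx, hy⟩ :=
      h (canon Γ E) (canon_sat Γ T hΓ E hT hE (fun x hx _ h => ⟨hx, h⟩))
    have key : ∀ c d, Proves0 Γ (Sent.someS c d) → Proves0 Γ (Sent.allS c x) →
        Proves0 Γ (Sent.allS d y) → Proves0 Γ (Sent.someS x y) :=
      fun c d h1 h2 h3 => ((h1.some2.darii h2).some2).darii h3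
    rcases (truth Γ T E hT hE x hs.1 _).1 hx with hx | hx <;>
      rcases (truth Γ T E hT hE y hs.2 _).1 hy with hy | hy
    · exact key a a hab.some1 hx hy
    · exact key a b hab hx hy
    · exact key b a hab.some2 hx hy
    · exact key b b hab.some2.some1 hx hy
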